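/- arXiv:2401.07425 — 6 statements merged into one kernel-verified Lean document; each statement's English description precedes it below -/
import Mathlib

section
/- Let (a, C̄, C) be feasible for the ORIGINAL problem. Define, for each k ∈ {1,…,K}, C_k⁺ := γ·C_{k−1} + a·Y_{k−1} − X_{k−1}, φ_k := C_k⁺ − C_k, φ⁺_k := max(φ_k, 0) and φ⁻_k := max(−φ_k, 0). Then the tuple (a, C̄, C, φ⁺, φ⁻) is feasible for the LP problem, and its LP cost J_LP(a, C̄, C, φ⁺, φ⁻) equals the original cost J_orig(a, C̄, C). -/
noncomputable section

/-- Saturation of `z` to the interval `[l, u]`. -/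
def clamp (z l u : ℝ) : ℝ := max l (min z u)

/-- Feasibility for the ORIGINAL sizing problem. -/
def OrigFeas (K : ℕ) (Y X : ℕ → ℝ) (αbar αlow γ R amax Chat : ℝ)
    (a Cbar : ℝ) (C : ℕ → ℝ) : Prop :=
  0 ≤ Cbar ∧ 0 ≤ a ∧ a ≤ amax ∧ C 0 = Chat ∧
  ∀ k ∈ Finset.Icc 1 K,
    C k = clamp (γ * C (k - 1) + a * Y (k - 1) - X (k - 1))
        (αlow * Cbar) (αbar * Cbar) ∧
    |C k - C (k - 1)| ≤ R * Cbar

/-- Cost of the ORIGINAL sizing problem. -/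
def Jorig (K : ℕ) (Y X : ℕ → ℝ) (PiPV PiB PiR PiG αbar αlow γ : ℝ)
    (a Cbar : ℝ) (C : ℕ → ℝ) : ℝ :=
  PiPV * a + PiB * Cbar +
    ∑ k ∈ Finset.Icc 1 K,
      (PiR * max (γ * C (k - 1) + a * Y (k - 1) - X (k - 1) - αbar * Cbar) 0 +
       PiG * max (αlow * Cbar - (γ * C (k - 1) + a * Y (k - 1) - X (k - 1))) 0)

/-- Feasibility for the LP relaxation. -/
def LPFeas (K : ℕ) (Y X : ℕ → ℝ) (αbar αlow γ R amax Chat : ℝ)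
    (a Cbar : ℝ) (C φp φm : ℕ → ℝ) : Prop :=
  0 ≤ Cbar ∧ 0 ≤ a ∧ a ≤ amax ∧ C 0 = Chat ∧
  ∀ k ∈ Finset.Icc 1 K,
    C k + φp k - φm k = γ * C (k - 1) + a * Y (k - 1) - X (k - 1) ∧
    αlow * Cbar ≤ C k ∧ C k ≤ αbar * Cbar ∧
    0 ≤ φp k ∧ 0 ≤ φm k ∧
    |C k - C (k - 1)| ≤ R * Cbar

/-- Cost of the LP relaxation. -/
def JLP (K : ℕ) (PiPV PiB PiR PiG : ℝ) (a Cbar : ℝ) (φp φm : ℕ → ℝ) : ℝ :=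
  PiPV * a + PiB * Cbar + ∑ k ∈ Finset.Icc 1 K, (PiR * φp k + PiG * φm k)

theorem le_clamp (z l u : ℝ) : l ≤ clamp z l u := le_max_left _ _

theorem clamp_le {l u : ℝ} (z : ℝ) (h : l ≤ u) : clamp z l u ≤ u :=
  max_le h (min_le_right _ _)

/-- The positive part of the clamping residual is the overshoot above the upper bound. -/
theorem max_sub_clamp_zero {l u : ℝ} (z : ℝ) (h : l ≤ u) :
    max (z - clamp z l u) 0 = max (z - u) 0 := by
  unfold clamp
  grind

/-- The negative part of the clamping residual is the shortfall below the lower bound. -/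
theorem max_neg_sub_clamp_zero {l u : ℝ} (z : ℝ) (h : l ≤ u) :
    max (-(z - clamp z l u)) 0 = max (l - z) 0 := by
  unfold clamp
  grind

/-- Every feasible point of the ORIGINAL problem yields, via
`φ_k = C_k⁺ − C_k`, `φ⁺ = max(φ,0)`, `φ⁻ = max(−φ,0)`, a feasible point of the
LP problem with the same cost. -/
theorem orig_feasible_to_LP_feasible
    (K : ℕ) (hK : 1 ≤ K) (Y X : ℕ → ℝ) (PiPV PiB PiR PiG : ℝ)
    (αbar αlow γ R amax Chat : ℝ)
    (hαbar : 1 / 2 < αbar ∧ αbar ≤ 1) (hαlow : 0 ≤ αlow ∧ αlow < 1 / 2)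
    (hγ : 0 < γ ∧ γ ≤ 1) (hR : 0 < R ∧ R ≤ 1) (hamax : 0 ≤ amax)
    (a Cbar : ℝ) (C : ℕ → ℝ)
    (hfeas : OrigFeas K Y X αbar αlow γ R amax Chat a Cbar C)
    (φp φm : ℕ → ℝ)
    (hφp : ∀ k, φp k =
      max ((γ * C (k - 1) + a * Y (k - 1) - X (k - 1)) - C k) 0)
    (hφm : ∀ k, φm k =
      max (-((γ * C (k - 1) + a * Y (k - 1) - X (k - 1)) - C k)) 0) :
    LPFeas K Y X αbar αlow γ R amax Chat a Cbar C φp φm ∧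
    JLP K PiPV PiB PiR PiG a Cbar φp φm =
      Jorig K Y X PiPV PiB PiR PiG αbar αlow γ a Cbar C := by
  obtain ⟨hC, ha, ha', h0, hstep⟩ := hfeas
  have hlu : αlow * Cbar ≤ αbar * Cbar :=
    mul_le_mul_of_nonneg_right (by linarith [hαbar.1, hαlow.2]) hC
  refine ⟨⟨hC, ha, ha', h0, fun k hk => ?_⟩, ?_⟩
  · obtain ⟨hk₁, hk₂⟩ := hstep k hk
    refine ⟨?_, hk₁ ▸ le_clamp _ _ _, hk₁ ▸ clamp_le _ hlu,
      hφp k ▸ le_max_right _ _, hφm k ▸ le_max_right _ _, hk₂⟩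
    have h := max_zero_sub_max_neg_zero_eq_self
      ((γ * C (k - 1) + a * Y (k - 1) - X (k - 1)) - C k)
    rw [← hφp k, ← hφm k] at h
    linarith
  · unfold JLP Jorig
    congr 1
    refine Finset.sum_congr rfl fun k hk => ?_
    rw [hφp, hφm, (hstep k hk).1, max_sub_clamp_zero _ hlu, max_neg_sub_clamp_zero _ hlu]

end
end

section
/- Assume γ = 1. Let (a*, C̄*, C*, φ⁺*, φ⁻*) be LP-feasible and attain the infimum of J_LP over all LP-feasible tuples. Suppose there exist j ∈ {2,…,K} and Δ ≠ 0 such that the Δ⁺-shift at j (defined by C′_{j−1} = C*_{j−1} + Δ, C′_k = C*_k otherwise; φ⁺′_{j−1} = φ⁺*_{j−1} − Δ, φ⁺′_j = φ⁺*_j + Δ, φ⁺′_k = φ⁺*_k otherwise; φ⁻ and a*, C̄* unchanged) satisfies α̲·C̄* ≤ C′_k ≤ ᾱ·C̄*, φ⁺′_k ≥ 0 and |C′_k − C′_{k−1}| ≤ R·C̄* for every k. Then the Δ⁺-shift is LP-feasible, its cost J_LP equals the optimal value, and hence the LP problem has at least two (distinct) optimal solutions. -/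
noncomputable section

/-- (γ = 1.) If an optimal LP solution admits a feasible Δ⁺-shift at some
`j ∈ {2,…,K}` with `Δ ≠ 0`, then the shifted tuple is LP-feasible with the same
(optimal) cost, giving a second, distinct optimal solution. -/
theorem delta_plus_shift_optimal
    (K : ℕ) (hK : 2 ≤ K) (Y X : ℕ → ℝ) (PiPV PiB PiR PiG : ℝ)
    (αbar αlow R amax Chat : ℝ)
    (hαbar : 1 / 2 < αbar ∧ αbar ≤ 1) (hαlow : 0 ≤ αlow ∧ αlow < 1 / 2)
    (hR : 0 < R ∧ R ≤ 1) (hamax : 0 ≤ amax)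
    (a Cbar : ℝ) (C φp φm : ℕ → ℝ)
    (hfeas : LPFeas K Y X αbar αlow 1 R amax Chat a Cbar C φp φm)
    (hopt : ∀ (a' Cbar' : ℝ) (C' φp' φm' : ℕ → ℝ),
      LPFeas K Y X αbar αlow 1 R amax Chat a' Cbar' C' φp' φm' →
      JLP K PiPV PiB PiR PiG a Cbar φp φm ≤
        JLP K PiPV PiB PiR PiG a' Cbar' φp' φm')
    (j : ℕ) (hj : j ∈ Finset.Icc 2 K) (Δ : ℝ) (hΔ : Δ ≠ 0)
    (C' φp' : ℕ → ℝ)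
    (hC'1 : C' (j - 1) = C (j - 1) + Δ)
    (hC'2 : ∀ k, k ≠ j - 1 → C' k = C k)
    (hφ1 : φp' (j - 1) = φp (j - 1) - Δ)
    (hφ2 : φp' j = φp j + Δ)
    (hφ3 : ∀ k, k ≠ j - 1 → k ≠ j → φp' k = φp k)
    (hshift : ∀ k ∈ Finset.Icc 1 K,
      αlow * Cbar ≤ C' k ∧ C' k ≤ αbar * Cbar ∧ 0 ≤ φp' k ∧
      |C' k - C' (k - 1)| ≤ R * Cbar) :
    LPFeas K Y X αbar αlow 1 R amax Chat a Cbar C' φp' φm ∧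
    JLP K PiPV PiB PiR PiG a Cbar φp' φm =
      JLP K PiPV PiB PiR PiG a Cbar φp φm ∧
    (C', φp') ≠ (C, φp) := by
  obtain ⟨i, rfl⟩ : ∃ i, j = i + 1 := ⟨j - 1, by grind⟩
  obtain ⟨hi, hiK⟩ := Finset.mem_Icc.mp hj
  simp only [Nat.add_sub_cancel] at hC'1 hC'2 hφ1 hφ3
  have hφ : ∀ k, φp' k = φp k + ((if k = i + 1 then Δ else 0) - if k = i then Δ else 0) := by
    intro k
    by_cases h₁ : k = i
    · subst h₁
      simp [hφ1, sub_eq_add_neg]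
    · by_cases h₂ : k = i + 1
      · subst h₂
        simp [hφ2]
      · simp [hφ3 k h₁ h₂, h₁, h₂]
  refine ⟨?_, ?_, ?_⟩
  · obtain ⟨hCbar, ha, ha', hC0, hk⟩ := hfeas
    refine ⟨hCbar, ha, ha', by rw [hC'2 0 (by omega), hC0], fun k hkK => ?_⟩
    obtain ⟨hdyn, -, -, -, hφm, -⟩ := hk k hkK
    obtain ⟨hlow, hup, hφp, hrate⟩ := hshift k hkK
    refine ⟨?_, hlow, hup, hφp, hφm, hrate⟩
    have hk1 := (Finset.mem_Icc.mp hkK).1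
    by_cases h₁ : k = i
    · subst h₁
      rw [hC'1, hφ1, hC'2 (k - 1) (by omega)]
      linarith
    · by_cases h₂ : k = i + 1
      · subst h₂
        simp only [Nat.add_sub_cancel] at hdyn ⊢
        rw [hC'2 _ h₁, hφ2, hC'1]
        linarith
      · rw [hC'2 k h₁, hφ3 k h₁ h₂, hC'2 (k - 1) (by omega)]
        exact hdyn
  · have hi_mem : i ∈ Finset.Icc 1 K := Finset.mem_Icc.mpr ⟨by omega, by omega⟩
    have hi_succ_mem : i + 1 ∈ Finset.Icc 1 K := Finset.mem_Icc.mpr ⟨by omega, hiK⟩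
    have hsum : ∑ k ∈ Finset.Icc 1 K, φp' k = ∑ k ∈ Finset.Icc 1 K, φp k := by
      simp_rw [hφ]
      rw [Finset.sum_add_distrib, Finset.sum_sub_distrib, Finset.sum_ite_eq',
        Finset.sum_ite_eq', if_pos hi_mem, if_pos hi_succ_mem, sub_self, add_zero]
    simp only [JLP, Finset.sum_add_distrib, ← Finset.mul_sum, hsum]
  · intro h
    have hC : C' i = C i := congrFun (Prod.mk.inj h).1 i
    exact hΔ (by linarith)

end
end

section
/- Assume γ = 1. Let (a*, C̄*, C*, φ⁺*, φ⁻*) be LP-feasible and attain the infimum of J_LP over all LP-feasible tuples. Suppose there exist j ∈ {2,…,K} and Δ ≠ 0 such that the Δ⁻-shift at j (defined by C′_{j−1} = C*_{j−1} − Δ, C′_k = C*_k otherwise; φ⁻′_{j−1} = φ⁻*_{j−1} − Δ, φ⁻′_j = φ⁻*_j + Δ, φ⁻′_k = φ⁻*_k otherwise; φ⁺ and a*, C̄* unchanged) satisfies α̲·C̄* ≤ C′_k ≤ ᾱ·C̄*, φ⁻′_k ≥ 0 and |C′_k − C′_{k−1}| ≤ R·C̄* for every k. Then the Δ⁻-shift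 is LP-feasible, its cost J_LP equals the optimal value, and hence the LP problem has at least two (distinct) optimal solutions. -/
noncomputable section

/-- (γ = 1.) If an optimal LP solution admits a feasible Δ⁻-shift at some
`j ∈ {2,…,K}` with `Δ ≠ 0`, then the shifted tuple is LP-feasible with the same
(optimal) cost, giving a second, distinct optimal solution. -/
theorem delta_minus_shift_optimal
    (K : ℕ) (hK : 2 ≤ K) (Y X : ℕ → ℝ) (PiPV PiB PiR PiG : ℝ)
    (αbar αlow R amax Chat : ℝ)
    (hαbar : 1 / 2 < αbar ∧ αbar ≤ 1) (hαlow : 0 ≤ αlow ∧ αlow < 1 / 2)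
    (hR : 0 < R ∧ R ≤ 1) (hamax : 0 ≤ amax)
    (a Cbar : ℝ) (C φp φm : ℕ → ℝ)
    (hfeas : LPFeas K Y X αbar αlow 1 R amax Chat a Cbar C φp φm)
    (hopt : ∀ (a' Cbar' : ℝ) (C' φp' φm' : ℕ → ℝ),
      LPFeas K Y X αbar αlow 1 R amax Chat a' Cbar' C' φp' φm' →
      JLP K PiPV PiB PiR PiG a Cbar φp φm ≤
        JLP K PiPV PiB PiR PiG a' Cbar' φp' φm')
    (j : ℕ) (hj : j ∈ Finset.Icc 2 K) (Δ : ℝ) (hΔ : Δ ≠ 0)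
    (C' φm' : ℕ → ℝ)
    (hC'1 : C' (j - 1) = C (j - 1) - Δ)
    (hC'2 : ∀ k, k ≠ j - 1 → C' k = C k)
    (hφ1 : φm' (j - 1) = φm (j - 1) - Δ)
    (hφ2 : φm' j = φm j + Δ)
    (hφ3 : ∀ k, k ≠ j - 1 → k ≠ j → φm' k = φm k)
    (hshift : ∀ k ∈ Finset.Icc 1 K,
      αlow * Cbar ≤ C' k ∧ C' k ≤ αbar * Cbar ∧ 0 ≤ φm' k ∧
      |C' k - C' (k - 1)| ≤ R * Cbar) :
    LPFeas K Y X αbar αlow 1 R amax Chat a Cbar C' φp φm' ∧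
    JLP K PiPV PiB PiR PiG a Cbar φp φm' =
      JLP K PiPV PiB PiR PiG a Cbar φp φm ∧
    (C', φm') ≠ (C, φm) := by
  have hj2 : 2 ≤ j := (Finset.mem_Icc.mp hj).1
  have hjK : j ≤ K := (Finset.mem_Icc.mp hj).2
  obtain ⟨hCbar, ha, ha', hC0, hstep⟩ := hfeas
  refine ⟨⟨hCbar, ha, ha', ?_, fun k hk => ?_⟩, ?_, ?_⟩
  · rw [hC'2 0 (by omega), hC0]
  · have hk1 : 1 ≤ k := (Finset.mem_Icc.mp hk).1
    obtain ⟨hbal, -, -, hφp, -, -⟩ := hstep k hk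
    obtain ⟨hlow, hup, hφm, hramp⟩ := hshift k hk
    refine ⟨?_, hlow, hup, hφp, hφm, hramp⟩
    by_cases hkj : k = j
    · subst hkj
      rw [hC'2 k (by omega), hφ2, hC'1]
      linarith
    · rw [hC'2 (k - 1) (by omega)]
      by_cases hkj' : k = j - 1
      · subst hkj'
        rw [hC'1, hφ1]
        linarith
      · rw [hC'2 k hkj', hφ3 k hkj' hkj]
        exact hbal
  · have hsum : ∑ k ∈ Finset.Icc 1 K, φm' k = ∑ k ∈ Finset.Icc 1 K, φm k := by
      rw [← sub_eq_zero, ← Finset.sum_sub_distrib,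
        Finset.sum_eq_add_of_mem (j - 1) j (Finset.mem_Icc.mpr (by omega))
          (Finset.mem_Icc.mpr (by omega)) (by omega)
          (fun k _ hk => by rw [hφ3 k hk.1 hk.2, sub_self]), hφ1, hφ2]
      ring
    simp only [JLP, Finset.sum_add_distrib, ← Finset.mul_sum, hsum]
  · intro h
    have hC := congrFun (congrArg Prod.fst h) (j - 1)
    simp only [hC'1, sub_eq_self] at hC
    exact hΔ hC

end
end

section
/- Assume γ = 1. Let (a*, C̄*, C*, φ⁺*, φ⁻*) be LP-feasible, and suppose for some j ∈ {2,…,K}: C*_j = ᾱ·C̄* (the battery is full at step j); α̲·C̄* < C*_{j−1} ≤ ᾱ·C̄* (the battery is not empty at step j−1); φ⁻*_{j−1} = 0 and φ⁻*_j = 0 (the fuel cell is off); φ⁺*_j > 0 (strictly positive reverse power at step j); and the charging-rate constraints are inactive at steps j−1 and j, i.e. |C*_{j−1} − C*_{j−2}| < R·C̄* and |C*_j − C*_{j−1}| < R·C̄*. Then there exists Δ < 0 such that the Δ⁺-shift at j (defined by C′_{j−1} = C*_{j−1} + Δ, C′_k = C*_k otherwise; φ⁺′_{j−1} = φ⁺*_{j−1}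 − Δ, φ⁺′_j = φ⁺*_j + Δ, φ⁺′_k = φ⁺*_k otherwise; φ⁻ and a*, C̄* unchanged) is LP-feasible. -/
noncomputable section

/-- (γ = 1.) If at some step `j ∈ {2,…,K}` the battery is full, was not empty at
`j−1`, the fuel cell is off at `j−1` and `j`, reverse power at `j` is strictly
positive, and the charging-rate constraints are inactive at `j−1` and `j`, then
some Δ⁺-shift at `j` with `Δ < 0` is LP-feasible. -/
theorem exists_feasible_delta_plus_shift
    (K : ℕ) (hK : 2 ≤ K) (Y X : ℕ → ℝ) (PiPV PiB PiR PiG : ℝ)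
    (αbar αlow R amax Chat : ℝ)
    (hαbar : 1 / 2 < αbar ∧ αbar ≤ 1) (hαlow : 0 ≤ αlow ∧ αlow < 1 / 2)
    (hR : 0 < R ∧ R ≤ 1) (hamax : 0 ≤ amax)
    (a Cbar : ℝ) (C φp φm : ℕ → ℝ)
    (hfeas : LPFeas K Y X αbar αlow 1 R amax Chat a Cbar C φp φm)
    (j : ℕ) (hj : j ∈ Finset.Icc 2 K)
    (hfull : C j = αbar * Cbar)
    (hnotempty : αlow * Cbar < C (j - 1) ∧ C (j - 1) ≤ αbar * Cbar)
    (hfcoff1 : φm (j - 1) = 0) (hfcoff2 : φm j = 0)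
    (hrev : 0 < φp j)
    (hrate1 : |C (j - 1) - C (j - 2)| < R * Cbar)
    (hrate2 : |C j - C (j - 1)| < R * Cbar) :
    ∃ Δ : ℝ, Δ < 0 ∧
      LPFeas K Y X αbar αlow 1 R amax Chat a Cbar
        (Function.update C (j - 1) (C (j - 1) + Δ))
        (Function.update (Function.update φp (j - 1) (φp (j - 1) - Δ)) j
          (φp j + Δ))
        φm := by
  obtain ⟨hC0, ha0, ha1, hinit, hstep⟩ := hfeas
  obtain ⟨m, rfl⟩ : ∃ m, j = m + 2 := ⟨j - 2, by have := Finset.mem_Icc.mp hj; omega⟩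
  have hm : m + 2 ≤ K := (Finset.mem_Icc.mp hj).2
  have hj1 : m + 2 - 1 = m + 1 := rfl
  have hj2 : m + 2 - 2 = m := rfl
  rw [hj1] at *
  rw [hj2] at *
  obtain ⟨ε, hε, hεlt⟩ := exists_between
    (show 0 < min (min (C (m + 1) - αlow * Cbar) (φp (m + 2)))
        (min (R * Cbar - |C (m + 1) - C m|) (R * Cbar - |C (m + 2) - C (m + 1)|)) from
      lt_min (lt_min (sub_pos.2 hnotempty.1) hrev)
        (lt_min (sub_pos.2 hrate1) (sub_pos.2 hrate2)))
  simp only [lt_min_iff] at hεlt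
  obtain ⟨⟨hlow, hphi⟩, hr1, hr2⟩ := hεlt
  refine ⟨-ε, neg_lt_zero.2 hε, hC0, ha0, ha1, ?_, ?_⟩
  · rwa [Function.update_of_ne (by omega)]
  intro k hk
  obtain ⟨hbal, hlo, hhi, hp, hn, hrate⟩ := hstep k hk
  obtain ⟨n, rfl⟩ : ∃ n, k = n + 1 := ⟨k - 1, by have := Finset.mem_Icc.mp hk; omega⟩
  simp only [Nat.add_sub_cancel] at *
  rcases eq_or_ne n m with rfl | hnm
  · have habs := abs_le.1 (le_refl |C (n + 1) - C n|)
    simp only [Function.update_self, Function.update_of_ne (show n + 1 ≠ n + 2 by omega),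
      Function.update_of_ne (show n ≠ n + 1 by omega)]
    exact ⟨by linarith, by linarith, by linarith, by linarith, hn,
      abs_le.2 ⟨by linarith, by linarith⟩⟩
  rcases eq_or_ne n (m + 1) with rfl | hnm1
  · have habs := abs_le.1 (le_refl |C (m + 2) - C (m + 1)|)
    simp only [Function.update_self, add_assoc, Nat.reduceAdd,
      Function.update_of_ne (show m + 2 ≠ m + 1 by omega)] at *
    exact ⟨by linarith, hlo, hhi, by linarith, hn,
      abs_le.2 ⟨by linarith, by linarith⟩⟩
  · rw [Function.update_of_ne (show n + 1 ≠ m + 1 by omega), Function.update_of_ne hnm1,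
      Function.update_of_ne (show n + 1 ≠ m + 2 by omega),
      Function.update_of_ne (show n + 1 ≠ m + 1 by omega)]
    exact ⟨hbal, hlo, hhi, hp, hn, hrate⟩

end
end

section
/- Assume γ = 1. Let (a*, C̄*, C*, φ⁺*, φ⁻*) be LP-feasible, and suppose for some j ∈ {2,…,K}: C*_j = α̲·C̄* (the battery is empty at step j); α̲·C̄* ≤ C*_{j−1} < ᾱ·C̄* (the battery is not full at step j−1); φ⁺*_{j−1} = 0 and φ⁺*_j = 0 (no reverse power is returned to the grid); φ⁻*_j > 0 (strictly positive fuel-cell generation at step j); and the charging-rate constraints are inactive at steps j−1 and j, i.e. |C*_{j−1} − C*_{j−2}| < R·C̄* and |C*_j − C*_{j−1}| < R·C̄*. Then there exists Δ < 0 such that the Δ⁻-shift at j (defined by C′_{j−1} = C*_{j−1} − Δ, C′_k = C*_k otherwise; φ⁻′_{j−1} = φ⁻*_{j−1} − Δ, φ⁻′_j = φ⁻*_j + Δ, φ⁻′_k = φ⁻*_k otherwise; φ⁺ and a*, C̄* unchanged) is LP-feasible. -/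
noncomputable section

/-- (γ = 1.) If at some step `j ∈ {2,…,K}` the battery is empty, was not full at
`j−1`, no reverse power is returned at `j−1` and `j`, fuel-cell generation at `j`
is strictly positive, and the charging-rate constraints are inactive at `j−1`
and `j`, then some Δ⁻-shift at `j` with `Δ < 0` is LP-feasible. -/
theorem exists_feasible_delta_minus_shift
    (K : ℕ) (hK : 2 ≤ K) (Y X : ℕ → ℝ) (PiPV PiB PiR PiG : ℝ)
    (αbar αlow R amax Chat : ℝ)
    (hαbar : 1 / 2 < αbar ∧ αbar ≤ 1) (hαlow : 0 ≤ αlow ∧ αlow < 1 / 2)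
    (hR : 0 < R ∧ R ≤ 1) (hamax : 0 ≤ amax)
    (a Cbar : ℝ) (C φp φm : ℕ → ℝ)
    (hfeas : LPFeas K Y X αbar αlow 1 R amax Chat a Cbar C φp φm)
    (j : ℕ) (hj : j ∈ Finset.Icc 2 K)
    (hempty : C j = αlow * Cbar)
    (hnotfull : αlow * Cbar ≤ C (j - 1) ∧ C (j - 1) < αbar * Cbar)
    (hrevoff1 : φp (j - 1) = 0) (hrevoff2 : φp j = 0)
    (hfc : 0 < φm j)
    (hrate1 : |C (j - 1) - C (j - 2)| < R * Cbar)
    (hrate2 : |C j - C (j - 1)| < R * Cbar) :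
    ∃ Δ : ℝ, Δ < 0 ∧
      LPFeas K Y X αbar αlow 1 R amax Chat a Cbar
        (Function.update C (j - 1) (C (j - 1) - Δ))
        φp
        (Function.update (Function.update φm (j - 1) (φm (j - 1) - Δ)) j
          (φm j + Δ)) := by
  obtain ⟨h0, ha, ha', hC0, h⟩ := hfeas
  obtain ⟨i, rfl⟩ : ∃ i, j = i + 2 := ⟨j - 2, by grind⟩
  simp only [Nat.add_sub_cancel, show i + 2 - 1 = i + 1 by omega] at *
  rw [abs_lt] at hrate1 hrate2
  obtain ⟨ε, hε, hε'⟩ : ∃ ε, 0 < ε ∧ ε < min (min (αbar * Cbar - C (i + 1)) (φm (i + 2)))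
      (min (R * Cbar - (C (i + 1) - C i)) (R * Cbar + (C (i + 2) - C (i + 1)))) :=
    exists_between (by simp only [lt_min_iff]; refine ⟨⟨?_, ?_⟩, ?_, ?_⟩ <;> linarith)
  simp only [lt_min_iff] at hε'
  obtain ⟨⟨h1, h2⟩, h3, h4⟩ := hε'
  refine ⟨-ε, by linarith, h0, ha, ha', by simp [hC0], fun k hk => ?_⟩
  have hk' := h k hk
  rw [abs_le] at hk' ⊢
  obtain ⟨e1, e2, e3, e4, e5, e6, e7⟩ := hk'
  by_cases hk1 : k = i + 1
  · subst hk1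
    simp at e1 e6 e7 ⊢
    refine ⟨?_, ?_, ?_, ?_, ?_, ?_, ?_⟩ <;> linarith
  by_cases hk2 : k = i + 2
  · subst hk2
    simp at e1 e6 e7 ⊢
    refine ⟨?_, ?_, ?_, ?_, ?_, ?_, ?_⟩ <;> linarith
  have hk3 : k - 1 ≠ i + 1 := by omega
  simp only [Function.update_of_ne hk1, Function.update_of_ne hk2, Function.update_of_ne hk3]
  exact ⟨e1, e2, e3, e4, e5, e6, e7⟩

end
end

section
/- Assume γ = 1. Let (a*, C̄*, C*, φ⁺*, φ⁻*) be LP-feasible and attain the infimum of J_LP over all LP-feasible tuples, and suppose for some j ∈ {2,…,K} either (i) C*_j = ᾱ·C̄*, α̲·C̄* < C*_{j−1} ≤ ᾱ·C̄*, φ⁻*_{j−1} = 0, φ⁻*_j = 0, φ⁺*_j > 0, and |C*_{j−1} − C*_{j−2}| < R·C̄*, |C*_j − C*_{j−1}| < R·C̄*; or (ii) C*_j = α̲·C̄*, α̲·C̄* ≤ C*_{j−1} < ᾱ·C̄*, φ⁺*_{j−1} = 0, φ⁺*_j = 0, φ⁻*_j > 0, and |C*_{j−1} − C*_{j−2}|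 < R·C̄*, |C*_j − C*_{j−1}| < R·C̄*. Then there exists δ < 0 such that for every Δ ∈ (δ, 0) the corresponding Δ⁺-shift at j (in case (i)) or Δ⁻-shift at j (in case (ii)) is LP-feasible and attains the optimal value of J_LP; in particular, the set of optimal solutions of the LP problem is infinite. -/
noncomputable section

/-- Case (i): at step `j` the battery is full, was not empty at `j−1`, the fuel
cell is off at `j−1` and `j`, reverse power at `j` is strictly positive, and the
charging-rate constraints are inactive at `j−1` and `j`. -/
def CaseI (αbar αlow R Cbar : ℝ) (C φp φm : ℕ → ℝ) (j : ℕ) : Prop :=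
  C j = αbar * Cbar ∧ αlow * Cbar < C (j - 1) ∧ C (j - 1) ≤ αbar * Cbar ∧
  φm (j - 1) = 0 ∧ φm j = 0 ∧ 0 < φp j ∧
  |C (j - 1) - C (j - 2)| < R * Cbar ∧ |C j - C (j - 1)| < R * Cbar

/-- Case (ii): at step `j` the battery is empty, was not full at `j−1`, no
reverse power is returned at `j−1` and `j`, fuel-cell generation at `j` is
strictly positive, and the charging-rate constraints are inactive at `j−1` and
`j`. -/
def CaseII (αbar αlow R Cbar : ℝ) (C φp φm : ℕ → ℝ) (j : ℕ) : Prop :=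
  C j = αlow * Cbar ∧ αlow * Cbar ≤ C (j - 1) ∧ C (j - 1) < αbar * Cbar ∧
  φp (j - 1) = 0 ∧ φp j = 0 ∧ 0 < φm j ∧
  |C (j - 1) - C (j - 2)| < R * Cbar ∧ |C j - C (j - 1)| < R * Cbar

/-- The state trajectory of the Δ⁺-shift at `j`. -/
def shiftCp (C : ℕ → ℝ) (j : ℕ) (Δ : ℝ) : ℕ → ℝ :=
  Function.update C (j - 1) (C (j - 1) + Δ)

/-- The reverse-power variables of the Δ⁺-shift at `j`. -/
def shiftPhiP (φp : ℕ → ℝ) (j : ℕ) (Δ : ℝ) : ℕ → ℝ :=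
  Function.update (Function.update φp (j - 1) (φp (j - 1) - Δ)) j (φp j + Δ)

/-- The state trajectory of the Δ⁻-shift at `j`. -/
def shiftCm (C : ℕ → ℝ) (j : ℕ) (Δ : ℝ) : ℕ → ℝ :=
  Function.update C (j - 1) (C (j - 1) - Δ)

/-- The fuel-cell variables of the Δ⁻-shift at `j`. -/
def shiftPhiM (φm : ℕ → ℝ) (j : ℕ) (Δ : ℝ) : ℕ → ℝ :=
  Function.update (Function.update φm (j - 1) (φm (j - 1) - Δ)) j (φm j + Δ)

/-- Moving an amount `Δ` of reverse power from step `j - 1` to step `j` preserves its total. -/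
lemma sum_shiftPhiP {K j : ℕ} (hj : j ∈ Finset.Icc 2 K) (φ : ℕ → ℝ) (Δ : ℝ) :
    ∑ k ∈ Finset.Icc 1 K, shiftPhiP φ j Δ k = ∑ k ∈ Finset.Icc 1 K, φ k := by
  rw [Finset.mem_Icc] at hj
  have h1 : j ∈ Finset.Icc 1 K := Finset.mem_Icc.2 (by lia)
  have h2 : j - 1 ∈ Finset.Icc 1 K := Finset.mem_Icc.2 (by lia)
  have h : ∀ k, shiftPhiP φ j Δ k =
      φ k + (if k = j then Δ else 0) - (if k = j - 1 then Δ else 0) := by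
    intro k
    simp only [shiftPhiP, Function.update_apply]
    split_ifs <;> first | lia | (subst_vars; ring)
  simp only [h, Finset.sum_sub_distrib, Finset.sum_add_distrib, Finset.sum_ite_eq', h1, h2, if_true]
  ring

lemma sum_shiftPhiM {K j : ℕ} (hj : j ∈ Finset.Icc 2 K) (φ : ℕ → ℝ) (Δ : ℝ) :
    ∑ k ∈ Finset.Icc 1 K, shiftPhiM φ j Δ k = ∑ k ∈ Finset.Icc 1 K, φ k :=
  sum_shiftPhiP hj φ Δ

lemma JLP_shiftPhiP {K j : ℕ} (hj : j ∈ Finset.Icc 2 K) (PiPV PiB PiR PiG a Cbar : ℝ)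
    (φp φm : ℕ → ℝ) (Δ : ℝ) :
    JLP K PiPV PiB PiR PiG a Cbar (shiftPhiP φp j Δ) φm =
      JLP K PiPV PiB PiR PiG a Cbar φp φm := by
  simp only [JLP, Finset.sum_add_distrib, ← Finset.mul_sum, sum_shiftPhiP hj]

lemma JLP_shiftPhiM {K j : ℕ} (hj : j ∈ Finset.Icc 2 K) (PiPV PiB PiR PiG a Cbar : ℝ)
    (φp φm : ℕ → ℝ) (Δ : ℝ) :
    JLP K PiPV PiB PiR PiG a Cbar φp (shiftPhiM φm j Δ) =
      JLP K PiPV PiB PiR PiG a Cbar φp φm := by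
  simp only [JLP, Finset.sum_add_distrib, ← Finset.mul_sum, sum_shiftPhiM hj]

lemma exists_feasible_shiftPos {K j : ℕ} {Y X : ℕ → ℝ}
    {αbar αlow R amax Chat a Cbar : ℝ} {C φp φm : ℕ → ℝ}
    (hfeas : LPFeas K Y X αbar αlow 1 R amax Chat a Cbar C φp φm)
    (hj : j ∈ Finset.Icc 2 K) (hcase : CaseI αbar αlow R Cbar C φp φm j) :
    ∃ δ : ℝ, δ < 0 ∧ ∀ Δ : ℝ, δ < Δ → Δ < 0 →
      LPFeas K Y X αbar αlow 1 R amax Chat a Cbar (shiftCp C j Δ) (shiftPhiP φp j Δ) φm := by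
  obtain ⟨hC, ha, ha', h0, hk⟩ := hfeas
  obtain ⟨hCj, hlow, hup, -, -, hφ, hr, hr'⟩ := hcase
  rw [Finset.mem_Icc] at hj
  set ε := min (min (C (j - 1) - αlow * Cbar) (φp j))
    (min (R * Cbar - |C (j - 1) - C (j - 2)|) (R * Cbar - |C j - C (j - 1)|)) with hε
  refine ⟨-ε, ?_, fun Δ hδ hΔ ↦ ⟨hC, ha, ha', ?_, fun k hkm ↦ ?_⟩⟩
  · simp only [hε, neg_lt_zero, lt_min_iff, sub_pos]
    exact ⟨⟨by assumption, hφ⟩, hr, hr'⟩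
  · rw [shiftCp, Function.update_of_ne (by lia), h0]
  have hlt : -Δ < ε := by linarith
  simp only [hε, lt_min_iff] at hlt
  obtain ⟨⟨h1, h2⟩, h3, h4⟩ := hlt
  obtain ⟨heq, hl, hu, hp, hm, hrate⟩ := hk k hkm
  rw [Finset.mem_Icc] at hkm
  rcases eq_or_ne k j with rfl | hkj
  · have e : k ≠ k - 1 := by lia
    simp only [shiftCp, shiftPhiP, Function.update_self, Function.update_of_ne e]
    refine ⟨by linarith, hl, hu, by linarith, by linarith, ?_⟩
    rw [abs_le]
    constructor <;> linarith [neg_abs_le (C k - C (k - 1)), le_abs_self (C k - C (k - 1))]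
  rcases eq_or_ne k (j - 1) with rfl | hkj'
  · have e : j - 1 - 1 ≠ j - 1 := by lia
    simp only [shiftCp, shiftPhiP, Function.update_self, Function.update_of_ne e, Function.update_of_ne hkj]
    have e' : j - 1 - 1 = j - 2 := by lia
    rw [e'] at heq ⊢
    refine ⟨by linarith, by linarith, by linarith, by linarith, by linarith, ?_⟩
    rw [abs_le]
    constructor <;>
      linarith [neg_abs_le (C (j - 1) - C (j - 2)), le_abs_self (C (j - 1) - C (j - 2))]
  · have e : k - 1 ≠ j - 1 := by lia
    simp only [shiftCp, shiftPhiP, Function.update_of_ne e, Function.update_of_ne hkj,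
      Function.update_of_ne hkj']
    exact ⟨heq, hl, hu, hp, hm, hrate⟩

lemma exists_feasible_shiftNeg {K j : ℕ} {Y X : ℕ → ℝ}
    {αbar αlow R amax Chat a Cbar : ℝ} {C φp φm : ℕ → ℝ}
    (hfeas : LPFeas K Y X αbar αlow 1 R amax Chat a Cbar C φp φm)
    (hj : j ∈ Finset.Icc 2 K) (hcase : CaseII αbar αlow R Cbar C φp φm j) :
    ∃ δ : ℝ, δ < 0 ∧ ∀ Δ : ℝ, δ < Δ → Δ < 0 →
      LPFeas K Y X αbar αlow 1 R amax Chat a Cbar (shiftCm C j Δ) φp (shiftPhiM φm j Δ) := by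
  obtain ⟨hC, ha, ha', h0, hk⟩ := hfeas
  obtain ⟨hCj, hlow, hup, -, -, hφ, hr, hr'⟩ := hcase
  rw [Finset.mem_Icc] at hj
  set ε := min (min (αbar * Cbar - C (j - 1)) (φm j))
    (min (R * Cbar - |C (j - 1) - C (j - 2)|) (R * Cbar - |C j - C (j - 1)|)) with hε
  refine ⟨-ε, ?_, fun Δ hδ hΔ ↦ ⟨hC, ha, ha', ?_, fun k hkm ↦ ?_⟩⟩
  · simp only [hε, neg_lt_zero, lt_min_iff, sub_pos]
    exact ⟨⟨by assumption, hφ⟩, hr, hr'⟩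
  · rw [shiftCm, Function.update_of_ne (by lia), h0]
  have hlt : -Δ < ε := by linarith
  simp only [hε, lt_min_iff] at hlt
  obtain ⟨⟨h1, h2⟩, h3, h4⟩ := hlt
  obtain ⟨heq, hl, hu, hp, hm, hrate⟩ := hk k hkm
  rw [Finset.mem_Icc] at hkm
  rcases eq_or_ne k j with rfl | hkj
  · have e : k ≠ k - 1 := by lia
    simp only [shiftCm, shiftPhiM, Function.update_self, Function.update_of_ne e]
    refine ⟨by linarith, hl, hu, by linarith, by linarith, ?_⟩
    rw [abs_le]
    constructor <;> linarith [neg_abs_le (C k - C (k - 1)), le_abs_self (C k - C (k - 1))]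
  rcases eq_or_ne k (j - 1) with rfl | hkj'
  · have e : j - 1 - 1 ≠ j - 1 := by lia
    simp only [shiftCm, shiftPhiM, Function.update_self, Function.update_of_ne e, Function.update_of_ne hkj]
    have e' : j - 1 - 1 = j - 2 := by lia
    rw [e'] at heq ⊢
    refine ⟨by linarith, by linarith, by linarith, by linarith, by linarith, ?_⟩
    rw [abs_le]
    constructor <;>
      linarith [neg_abs_le (C (j - 1) - C (j - 2)), le_abs_self (C (j - 1) - C (j - 2))]
  · have e : k - 1 ≠ j - 1 := by lia
    simp only [shiftCm, shiftPhiM, Function.update_of_ne e, Function.update_of_ne hkj,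
      Function.update_of_ne hkj']
    exact ⟨heq, hl, hu, hp, hm, hrate⟩

/-- (γ = 1.) If an optimal LP solution satisfies case (i) or case (ii) at some
`j ∈ {2,…,K}`, then there is `δ < 0` such that for every `Δ ∈ (δ, 0)` the
corresponding shifted tuple is LP-feasible and attains the optimal value; in
particular, the set of optimal solutions of the LP problem is infinite. -/
theorem infinitely_many_optimal_solutions
    (K : ℕ) (hK : 2 ≤ K) (Y X : ℕ → ℝ) (PiPV PiB PiR PiG : ℝ)
    (αbar αlow R amax Chat : ℝ)
    (hαbar : 1 / 2 < αbar ∧ αbar ≤ 1) (hαlow : 0 ≤ αlow ∧ αlow < 1 / 2)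
    (hR : 0 < R ∧ R ≤ 1) (hamax : 0 ≤ amax)
    (a Cbar : ℝ) (C φp φm : ℕ → ℝ)
    (hfeas : LPFeas K Y X αbar αlow 1 R amax Chat a Cbar C φp φm)
    (hopt : ∀ (a' Cbar' : ℝ) (C' φp' φm' : ℕ → ℝ),
      LPFeas K Y X αbar αlow 1 R amax Chat a' Cbar' C' φp' φm' →
      JLP K PiPV PiB PiR PiG a Cbar φp φm ≤
        JLP K PiPV PiB PiR PiG a' Cbar' φp' φm')
    (j : ℕ) (hj : j ∈ Finset.Icc 2 K)
    (hcase : CaseI αbar αlow R Cbar C φp φm j ∨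
             CaseII αbar αlow R Cbar C φp φm j) :
    (∃ δ : ℝ, δ < 0 ∧ ∀ Δ : ℝ, δ < Δ → Δ < 0 →
      (CaseI αbar αlow R Cbar C φp φm j →
        LPFeas K Y X αbar αlow 1 R amax Chat a Cbar
          (shiftCp C j Δ) (shiftPhiP φp j Δ) φm ∧
        JLP K PiPV PiB PiR PiG a Cbar (shiftPhiP φp j Δ) φm =
          JLP K PiPV PiB PiR PiG a Cbar φp φm) ∧
      (CaseII αbar αlow R Cbar C φp φm j →
        LPFeas K Y X αbar αlow 1 R amax Chat a Cbar
          (shiftCm C j Δ) φp (shiftPhiM φm j Δ) ∧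
        JLP K PiPV PiB PiR PiG a Cbar φp (shiftPhiM φm j Δ) =
          JLP K PiPV PiB PiR PiG a Cbar φp φm)) ∧
    Set.Infinite {p : ℝ × ℝ × (ℕ → ℝ) × (ℕ → ℝ) × (ℕ → ℝ) |
      LPFeas K Y X αbar αlow 1 R amax Chat p.1 p.2.1 p.2.2.1 p.2.2.2.1
        p.2.2.2.2 ∧
      JLP K PiPV PiB PiR PiG p.1 p.2.1 p.2.2.2.1 p.2.2.2.2 =
        JLP K PiPV PiB PiR PiG a Cbar φp φm} := by
  have hdisj : CaseI αbar αlow R Cbar C φp φm j → ¬ CaseII αbar αlow R Cbar C φp φm j :=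
    fun h h' ↦ h.2.2.2.2.2.1.ne' h'.2.2.2.2.1
  rcases hcase with h | h
  · obtain ⟨δ, hδ, hshift⟩ := exists_feasible_shiftPos hfeas hj h
    refine ⟨⟨δ, hδ, fun Δ h1 h2 ↦ ⟨fun _ ↦ ⟨hshift Δ h1 h2, JLP_shiftPhiP hj ..⟩,
      fun h' ↦ absurd h' (hdisj h)⟩⟩, ?_⟩
    refine Set.infinite_of_injOn_mapsTo (s := Set.Ioo δ 0)
      (f := fun Δ ↦ (a, Cbar, shiftCp C j Δ, shiftPhiP φp j Δ, φm)) ?_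
      (fun Δ hΔ ↦ ⟨hshift Δ hΔ.1 hΔ.2, JLP_shiftPhiP hj ..⟩) (Set.Ioo_infinite hδ)
    intro x _ y _ hxy
    simpa [shiftCp] using congrFun (congrArg (fun p ↦ p.2.2.1) hxy) (j - 1)
  · obtain ⟨δ, hδ, hshift⟩ := exists_feasible_shiftNeg hfeas hj h
    refine ⟨⟨δ, hδ, fun Δ h1 h2 ↦ ⟨fun h' ↦ absurd h (hdisj h'),
      fun _ ↦ ⟨hshift Δ h1 h2, JLP_shiftPhiM hj ..⟩⟩⟩, ?_⟩
    refine Set.infinite_of_injOn_mapsTo (s := Set.Ioo δ 0)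
      (f := fun Δ ↦ (a, Cbar, shiftCm C j Δ, φp, shiftPhiM φm j Δ)) ?_
      (fun Δ hΔ ↦ ⟨hshift Δ hΔ.1 hΔ.2, JLP_shiftPhiM hj ..⟩) (Set.Ioo_infinite hδ)
    intro x _ y _ hxy
    simpa [shiftCm] using congrFun (congrArg (fun p ↦ p.2.2.1) hxy) (j - 1)

end
end
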